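/- Fix β,ε∈(0,∞) and λ,h₀∈ℝ with ĥ := h₀ + h̄_{β,ε}(λ) ≠ 0. Then the Morita approximant measures converge weakly to the product measure with single-site marginal π_{λ;β,ε,h₀}[m^{CW}(β,ĥ)]: for every N₀∈ℕ and every (σ̄,η̄)∈{-1,1}^{N₀}×{-1,1}^{N₀}, the probability K̂_{λ;β,ε,h₀,N}(σ_i=σ̄_i and η_i=η̄_i for i=1,…,N₀) converges as N→∞ to ∏_{i=1}^{N₀} π_{λ;β,ε,h₀}[m^{CW}(β,ĥ)](σ̄_i,η̄_i). -/

import Mathlib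

open Real Filter MeasureTheory
open scoped Classical BigOperators

noncomputable section

/-- Map a Boolean to a ±1 spin value. -/
def spin (b : Bool) : ℝ := if b then 1 else -1

/-- Hamiltonian (with sign absorbed) of the Morita approximant measure. -/
def morH (N : ℕ) (β ε h₀ lam : ℝ) (σ η : Fin N → Bool) : ℝ :=
  β / (2 * N) * (∑ i, spin (σ i)) ^ 2
    + β * ∑ i, (ε * spin (η i) + h₀) * spin (σ i)
    + lam * ∑ i, spin (η i)

/-- Partition function of the Morita approximant measure. -/
def morZ (N : ℕ) (β ε h₀ lam : ℝ) : ℝ :=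
  ∑ σ : Fin N → Bool, ∑ η : Fin N → Bool, Real.exp (morH N β ε h₀ lam σ η)

/-- The Morita approximant measure on pairs of configurations. -/
def morK (N : ℕ) (β ε h₀ lam : ℝ) (σ η : Fin N → Bool) : ℝ :=
  Real.exp (morH N β ε h₀ lam σ η) / morZ N β ε h₀ lam

/-- Probability under the Morita approximant measure that the first `N₀`
random-field variables agree with `ηbar`. -/
def etaCylProb (N₀ N : ℕ) (β ε h₀ lam : ℝ) (ηbar : Fin N₀ → Bool) : ℝ :=
  ∑ σ : Fin N → Bool, ∑ η : Fin N → Bool,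
    if ∀ (i : Fin N₀) (h : (i : ℕ) < N), η ⟨i, h⟩ = ηbar i
    then morK N β ε h₀ lam σ η else 0

/-- `(h₀, lam)` is neutral: the η-marginal of the Morita approximant measures
converges weakly to the symmetric i.i.d. field distribution. -/
def IsNeutral (β ε h₀ lam : ℝ) : Prop :=
  ∀ (N₀ : ℕ) (ηbar : Fin N₀ → Bool),
    Tendsto (fun N => etaCylProb N₀ N β ε h₀ lam ηbar) atTop (nhds ((2 : ℝ)⁻¹ ^ N₀))

/-- The field-shift function `h̄_{β,ε}(λ)`. -/
def hbar (β ε lam : ℝ) : ℝ :=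
  1 / (2 * β) * Real.log (Real.cosh (lam + β * ε) / Real.cosh (lam - β * ε))

/-- The single-site joint kernel `π_{λ;β,ε,h₀}[m](σ₁,η₁)`. -/
def piK (β ε h₀ lam m : ℝ) (s t : Bool) : ℝ :=
  Real.exp (β * (m + ε * spin t + h₀) * spin s + lam * spin t) /
    (2 * (Real.cosh (β * (m + ε + h₀)) * Real.exp lam
        + Real.cosh (β * (m - ε + h₀)) * Real.exp (-lam)))

/-- Probability under the Morita approximant measure that the first `N₀` spins and
random fields agree with `(σbar, ηbar)`. -/
def pairCylProb (N₀ N : ℕ) (β ε h₀ lam : ℝ) (σbar ηbar : Fin N₀ → Bool) : ℝ :=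
  ∑ σ : Fin N → Bool, ∑ η : Fin N → Bool,
    if ∀ (i : Fin N₀) (h : (i : ℕ) < N), σ ⟨i, h⟩ = σbar i ∧ η ⟨i, h⟩ = ηbar i
    then morK N β ε h₀ lam σ η else 0

theorem laplace (c F : ℝ → ℝ) (m : ℝ) (hc : Continuous c) (hpos : ∀ x, 0 < c x)
    (hint : Integrable c) (hlim : Tendsto c (cocompact ℝ) (nhds 0))
    (hmax : ∀ x, x ≠ m → c x < c m) (hF : Continuous F) (hF1 : ∀ x, |F x| ≤ 1) :
    Tendsto (fun n : ℕ => (∫ x, c x ^ (n+1) * F x) / (∫ x, c x ^ (n+1))) atTop (nhds (F m)) := by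
  have hle : ∀ x, c x ≤ c m := fun x => by
    by_cases h : x = m
    · rw [h]
    · exact (hmax x h).le
  have hintn : ∀ n : ℕ, Integrable (fun x => c x ^ (n+1)) := fun n => by
    refine (hint.const_mul (c m ^ n)).mono' (by fun_prop) (ae_of_all _ fun x => ?_)
    rw [Real.norm_of_nonneg (pow_pos (hpos x) _).le, pow_succ]
    exact mul_le_mul_of_nonneg_right (pow_le_pow_left₀ (hpos x).le (hle x) n) (hpos x).le
  have hintF : ∀ n : ℕ, Integrable (fun x => c x ^ (n+1) * F x) := fun n => by
    refine (hintn n).mono' (by fun_prop) (ae_of_all _ fun x => ?_)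
    rw [norm_mul, Real.norm_of_nonneg (pow_pos (hpos x) _).le]
    exact mul_le_of_le_one_right (pow_pos (hpos x) _).le (hF1 x)
  rw [Metric.tendsto_atTop']
  intro e he
  obtain ⟨r, hr, hFr⟩ := Metric.continuous_iff.1 hF m (e/2) (by linarith)
  -- the bound away from the maximum
  obtain ⟨q, hq0, hqm, hq⟩ : ∃ q, 0 < q ∧ q < c m ∧ ∀ x, r ≤ dist x m → c x ≤ q := by
    have h1 : ∀ᶠ x in cocompact ℝ, c x < c m / 2 :=
      hlim.eventually (gt_mem_nhds (by linarith [hpos m]))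
    obtain ⟨K, hK, hKs⟩ := mem_cocompact.1 h1
    have hK' : IsCompact (K ∩ {x | r ≤ dist x m}) :=
      hK.inter_right (isClosed_le continuous_const (by fun_prop))
    rcases (K ∩ {x | r ≤ dist x m}).eq_empty_or_nonempty with he | hne
    · refine ⟨c m / 2, by linarith [hpos m], by linarith [hpos m], fun x hx => ?_⟩
      by_cases hxK : x ∈ K
      · have : x ∈ K ∩ {x | r ≤ dist x m} := ⟨hxK, hx⟩
        simp [he] at this
      · exact (hKs hxK).le
    · obtain ⟨y, hy, hym⟩ := hK'.exists_isMaxOn hne hc.continuousOn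
      have hyne : y ≠ m := by
        rintro rfl
        have := hy.2
        simp at this
        linarith
      refine ⟨max (c y) (c m / 2), lt_max_of_lt_left (hpos y),
        max_lt (hmax y hyne) (by linarith [hpos m]), fun x hx => ?_⟩
      by_cases hxK : x ∈ K
      · exact le_max_of_le_left (hym ⟨hxK, hx⟩)
      · exact le_max_of_le_right (hKs hxK).le
  obtain ⟨p, hqp, hpm⟩ := exists_between hqm
  have hp0 : 0 < p := hq0.trans hqp
  obtain ⟨s, hs, hsp⟩ : ∃ s > 0, ∀ x ∈ Set.Ioo (m - s) (m + s), p ≤ c x := by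
    have : ∀ᶠ x in nhds m, p < c x := hc.continuousAt.eventually (lt_mem_nhds hpm)
    obtain ⟨s, hs, h⟩ := Metric.eventually_nhds_iff_ball.1 this
    refine ⟨s, hs, fun x hx => (h x ?_).le⟩
    rwa [Real.ball_eq_Ioo]
  set J := ∫ x, c x with hJ
  have hJ0 : 0 ≤ J := integral_nonneg fun x => (hpos x).le
  have hI : ∀ n : ℕ, p ^ (n+1) * (2 * s) ≤ ∫ x, c x ^ (n+1) := fun n => by
    have h1 : ∫ x in Set.Ioo (m - s) (m + s), p ^ (n+1) ≤
        ∫ x in Set.Ioo (m - s) (m + s), c x ^ (n+1) := by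
      refine setIntegral_mono_on (by simp) (hintn n).integrableOn measurableSet_Ioo fun x hx => ?_
      exact pow_le_pow_left₀ hp0.le (hsp x hx) _
    have h2 : ∫ x in Set.Ioo (m - s) (m + s), c x ^ (n+1) ≤ ∫ x, c x ^ (n+1) :=
      setIntegral_le_integral (hintn n) (ae_of_all _ fun x => (pow_pos (hpos x) _).le)
    have h3 : ∫ x in Set.Ioo (m - s) (m + s), p ^ (n+1) = p ^ (n+1) * (2 * s) := by
      rw [setIntegral_const, Real.volume_real_Ioo_of_le (by linarith), smul_eq_mul]; ring
    linarith
  have hI0 : ∀ n : ℕ, 0 < ∫ x, c x ^ (n+1) := fun n =>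
    lt_of_lt_of_le (by positivity) (hI n)
  have hnum : ∀ n : ℕ, |(∫ x, c x ^ (n+1) * F x) - F m * ∫ x, c x ^ (n+1)| ≤
      e/2 * (∫ x, c x ^ (n+1)) + 2 * q ^ n * J := fun n => by
    rw [← integral_const_mul, ← integral_sub (hintF n) ((hintn n).const_mul _),
      hJ, ← integral_const_mul, ← integral_const_mul, ← integral_add ((hintn n).const_mul _) (hint.const_mul _), ← Real.norm_eq_abs]
    refine norm_integral_le_of_norm_le (((hintn n).const_mul _).add (hint.const_mul _))
      (ae_of_all _ fun x => ?_)
    have e1 : c x ^ (n+1) * F x - F m * c x ^ (n+1) = c x ^ (n+1) * (F x - F m) := by ring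
    rw [e1, norm_mul, Real.norm_of_nonneg (pow_pos (hpos x) _).le, Real.norm_eq_abs]
    have hcn := pow_pos (hpos x) (n+1)
    have hqc : 0 < 2 * q ^ n * c x := by have := hpos x; positivity
    by_cases hx : dist x m < r
    · have h4 := hFr x hx
      rw [Real.dist_eq] at h4
      have := mul_le_mul_of_nonneg_left h4.le hcn.le
      linarith
    · have h5 : c x ^ (n+1) ≤ q ^ n * c x := by
        rw [pow_succ]
        exact mul_le_mul_of_nonneg_right
          (pow_le_pow_left₀ (hpos x).le (hq x (not_lt.1 hx)) n) (hpos x).le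
      have h6 : |F x - F m| ≤ 2 := by
        have := abs_sub (F x) (F m)
        linarith [hF1 x, hF1 m]
      have := mul_le_mul h5 h6 (abs_nonneg _) (by linarith)
      have : 0 < e/2 * c x ^ (n+1) := by positivity
      linarith
  have hz : Tendsto (fun n : ℕ => (J / (p * s)) * (q / p) ^ n) atTop (nhds 0) := by
    have := (tendsto_pow_atTop_nhds_zero_of_lt_one (r := q / p) (by positivity)
      ((div_lt_one hp0).2 hqp)).const_mul (J / (p * s))
    simpa using this
  obtain ⟨n₀, hn₀⟩ := eventually_atTop.1 (hz.eventually (gt_mem_nhds (show (0:ℝ) < e/2 by linarith)))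
  refine ⟨n₀, fun n hn => ?_⟩
  have h7 := hn₀ n hn.le
  rw [Real.dist_eq]
  have h8 : (∫ x, c x ^ (n+1) * F x) / (∫ x, c x ^ (n+1)) - F m =
      ((∫ x, c x ^ (n+1) * F x) - F m * ∫ x, c x ^ (n+1)) / (∫ x, c x ^ (n+1)) := by
    field_simp [(hI0 n).ne']
  rw [h8, abs_div, abs_of_pos (hI0 n), div_lt_iff₀ (hI0 n)]
  refine (hnum n).trans_lt ?_
  have h9 : 2 * q ^ n * J = (J / (p * s)) * (q / p) ^ n * (p ^ (n+1) * (2 * s)) := by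
    rw [div_pow]; field_simp; ring
  have h10 : (J / (p * s)) * (q / p) ^ n * (p ^ (n+1) * (2 * s)) < e/2 * (∫ x, c x ^ (n+1)) :=
    lt_of_lt_of_le (mul_lt_mul_of_pos_right h7 (by positivity))
      (mul_le_mul_of_nonneg_left (hI n) (by linarith))
  linarith

theorem tanh_sub_concave (β h : ℝ) (hβ : 0 < β) (hh : 0 < h) :
    StrictConcaveOn ℝ (Set.Ici 0) (fun x => Real.tanh (β * (x + h)) - x) := by
  have hd : ∀ x, HasDerivAt (fun x => Real.tanh (β * (x + h)) - x)
      (β / Real.cosh (β * (x + h)) ^ 2 - 1) x := fun x => by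
    have h1 : HasDerivAt (fun x => β * (x + h)) β x := by
      simpa using ((hasDerivAt_id x).add_const h).const_mul β
    have h2 : HasDerivAt (fun x => Real.sinh (β * (x + h)) / Real.cosh (β * (x + h)) - x)
      _ x := ((h1.sinh).div h1.cosh (Real.cosh_pos _).ne').sub (hasDerivAt_id x)
    simp only [Real.tanh_eq_sinh_div_cosh]
    convert h2 using 1
    congr 2
    have := Real.cosh_sq (β * (x + h))
    linear_combination (-β) * this
  apply StrictAntiOn.strictConcaveOn_of_deriv (convex_Ici 0)
  · exact fun x _ => (hd x).continuousAt.continuousWithinAt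
  · intro x hx y hy hxy
    rw [(hd x).deriv, (hd y).deriv]
    simp at hx hy
    have : Real.cosh (β * (x + h)) < Real.cosh (β * (y + h)) := by
      rw [Real.cosh_lt_cosh, abs_of_pos (by positivity), abs_of_pos (by positivity)]
      nlinarith
    have h0 := Real.cosh_pos (β * (x + h))
    gcongr

theorem max_pos (β h m : ℝ) (hβ : 0 < β) (hh : 0 < h) (hm0 : 0 < m)
    (hm : m = Real.tanh (β * (m + h))) (x : ℝ) (hx : x ≠ m) :
    Real.exp (-(β/2) * x^2) * Real.cosh (β * (x + h)) <
      Real.exp (-(β/2) * m^2) * Real.cosh (β * (m + h)) := by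
  set g : ℝ → ℝ := fun x => Real.exp (-(β/2) * x^2) * Real.cosh (β * (x + h)) with hg
  set φ : ℝ → ℝ := fun x => Real.tanh (β * (x + h)) - x with hφ
  have hconc := tanh_sub_concave β h hβ hh
  have hφm : φ m = 0 := by simp only [hφ]; linarith
  have hφ0 : 0 < φ 0 := by
    simp only [hφ, sub_zero, zero_add, Real.tanh_eq_sinh_div_cosh]
    exact div_pos (Real.sinh_pos_iff.2 (by positivity)) (Real.cosh_pos _)
  have hneg : ∀ y, m < y → φ y < 0 := fun y hy => by
    have h1 := hconc.2 (show (0:ℝ) ∈ Set.Ici 0 by simp) (show y ∈ Set.Ici 0 by simp; linarith) (by linarith)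
      (show 0 < 1 - m / y by rw [sub_pos, div_lt_one (by linarith)]; exact hy)
      (show 0 < m / y by apply div_pos <;> linarith) (by ring)
    have h2 : (1 - m/y) • (0:ℝ) + (m / y) • y = m := by
      simp only [smul_eq_mul]; field_simp [(show y ≠ 0 by linarith)]; ring
    rw [h2] at h1
    change (1 - m/y) • φ 0 + (m/y) • φ y < φ m at h1
    rw [hφm] at h1
    simp only [smul_eq_mul] at h1
    have h3 : 0 < m / y := by apply div_pos <;> linarith
    have h4 : 0 < (1 - m/y) * φ 0 := mul_pos (by rw [sub_pos, div_lt_one (by linarith)]; exact hy) hφ0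
    by_contra h5
    have := mul_nonneg h3.le (not_lt.1 h5)
    linarith
  have hposi : ∀ y, 0 < y → y < m → 0 < φ y := fun y hy0 hy => by
    have h3 : 0 < y / m := by positivity
    have h3' : 0 < 1 - y / m := by rw [sub_pos, div_lt_one (by linarith)]; exact hy
    have h1 := hconc.2 (show (0:ℝ) ∈ Set.Ici 0 by simp) (show m ∈ Set.Ici 0 by simp; linarith) (by linarith)
      h3' h3 (by ring)
    have h2 : (1 - y/m) • (0:ℝ) + (y / m) • m = y := by
      simp only [smul_eq_mul]; field_simp; ring
    rw [h2] at h1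
    change (1 - y/m) • φ 0 + (y/m) • φ m < φ y at h1
    rw [hφm] at h1
    simp only [smul_eq_mul] at h1
    have h4 : 0 < (1 - y/m) * φ 0 := mul_pos h3' hφ0
    linarith
  have hd : ∀ x, HasDerivAt g (β * g x * φ x) x := fun x => by
    have h1 : HasDerivAt (fun x => β * (x + h)) β x := by
      simpa using ((hasDerivAt_id x).add_const h).const_mul β
    have h2 : HasDerivAt (fun x => -(β/2) * x^2) (-(β/2) * (2 * x)) x := by
      simpa using (hasDerivAt_pow 2 x).const_mul (-(β/2))
    have h3 : HasDerivAt g _ x := h2.exp.mul h1.cosh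
    refine h3.congr_deriv (Eq.symm ?_)
    change β * (Real.exp (-(β/2) * x^2) * Real.cosh (β * (x + h))) * (Real.tanh (β * (x + h)) - x) = _
    rw [Real.tanh_eq_sinh_div_cosh]
    field_simp [(Real.cosh_pos (β * (x + h))).ne']
    ring
  have hgp : ∀ x, 0 < g x := fun x => mul_pos (Real.exp_pos _) (Real.cosh_pos _)
  have hcont : Continuous g := by simp only [hg]; fun_prop
  have hmono : StrictMonoOn g (Set.Icc 0 m) := by
    apply strictMonoOn_of_deriv_pos (convex_Icc 0 m) hcont.continuousOn
    intro y hy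
    simp at hy
    rw [(hd y).deriv]
    have := hposi y hy.1 hy.2
    have := hgp y
    positivity
  have hanti : StrictAntiOn g (Set.Ici m) := by
    apply strictAntiOn_of_deriv_neg (convex_Ici m) hcont.continuousOn
    intro y hy
    simp at hy
    rw [(hd y).deriv]
    exact mul_neg_of_pos_of_neg (mul_pos hβ (hgp y)) (hneg y hy)
  have hnn : ∀ y, 0 ≤ y → y ≠ m → g y < g m := fun y hy hne => by
    rcases lt_or_gt_of_ne hne with h1 | h1
    · exact hmono ⟨hy, h1.le⟩ ⟨hm0.le, le_rfl⟩ h1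
    · exact hanti (by simp) h1.le h1
  change g x < g m
  rcases le_or_gt 0 x with h0 | h0
  · exact hnn x h0 hx
  · have h1 : g x < g (-x) := by
      simp only [hg, neg_sq]
      apply mul_lt_mul_of_pos_left _ (Real.exp_pos _)
      rw [Real.cosh_lt_cosh, abs_mul, abs_mul]
      apply mul_lt_mul_of_pos_left _ (abs_pos.2 hβ.ne')
      rw [abs_of_pos (show 0 < -x + h by linarith), abs_lt]
      constructor <;> linarith
    have h2 : g (-x) ≤ g m := by
      by_cases h3 : -x = m
      · rw [h3]
      · exact (hnn (-x) (by linarith) h3).le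
    linarith

theorem max_all (β h m : ℝ) (hβ : 0 < β)
    (hm : m = Real.tanh (β * (m + h))) (hs : 0 < m * h) (x : ℝ) (hx : x ≠ m) :
    Real.exp (-(β/2) * x^2) * Real.cosh (β * (x + h)) <
      Real.exp (-(β/2) * m^2) * Real.cosh (β * (m + h)) := by
  rcases mul_pos_iff.1 hs with ⟨h1, h2⟩ | ⟨h1, h2⟩
  · exact max_pos β h m hβ h2 h1 hm x hx
  · have := max_pos β (-h) (-m) hβ (by linarith) (by linarith) (by
      rw [show β * (-m + -h) = -(β * (m + h)) by ring, Real.tanh_neg, ← hm]) (-x)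
      (fun h => hx (by linarith))
    rwa [show β * (-m + -h) = -(β * (m + h)) by ring, show β * (-x + -h) = -(β * (x + h)) by ring,
      Real.cosh_neg, Real.cosh_neg, neg_sq, neg_sq] at this

/-- single-site weight -/
def wt (β ε h₀ lam x : ℝ) (s t : Bool) : ℝ :=
  Real.exp (β * (x + ε * spin t + h₀) * spin s + lam * spin t)

/-- total single-site weight -/
def Wt (β ε h₀ lam x : ℝ) : ℝ :=
  2 * (Real.cosh (β * (x + ε + h₀)) * Real.exp lam
        + Real.cosh (β * (x - ε + h₀)) * Real.exp (-lam))

theorem Wt_sum (β ε h₀ lam x : ℝ) : ∑ s : Bool, ∑ t : Bool, wt β ε h₀ lam x s t = Wt β ε h₀ lam x := by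
  simp only [Fintype.sum_bool, wt, Wt, spin, Real.cosh_eq, if_true, Real.exp_add]
  simp only [Bool.false_eq_true, if_false]
  simp only [mul_one, mul_neg, ← sub_eq_add_neg]
  ring

theorem Wt_pos (β ε h₀ lam x : ℝ) : 0 < Wt β ε h₀ lam x := by
  have := Real.cosh_pos (β * (x + ε + h₀))
  have := Real.cosh_pos (β * (x - ε + h₀))
  unfold Wt; positivity

theorem Wt_cosh (β ε h₀ lam x : ℝ) (hβ : 0 < β) :
    Wt β ε h₀ lam x = 4 * Real.sqrt (Real.cosh (lam + β * ε) * Real.cosh (lam - β * ε)) *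
      Real.cosh (β * (x + (h₀ + hbar β ε lam))) := by
  set a := Real.cosh (lam + β * ε) with ha
  set b := Real.cosh (lam - β * ε) with hb
  have ha0 : 0 < a := Real.cosh_pos _
  have hb0 : 0 < b := Real.cosh_pos _
  have h1 : β * (x + (h₀ + hbar β ε lam)) = β * (x + h₀) + Real.log (a / b) / 2 := by
    unfold hbar; rw [← ha, ← hb]; field_simp; ring
  have hE : Real.exp (Real.log (a/b) / 2) = Real.sqrt a / Real.sqrt b := by
    rw [Real.exp_half, Real.exp_log (by positivity), Real.sqrt_div ha0.le]
  have h2 : Real.sqrt (a * b) = Real.sqrt a * Real.sqrt b := Real.sqrt_mul ha0.le _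
  have hsa := Real.sqrt_pos.2 ha0
  have hsb := Real.sqrt_pos.2 hb0
  rw [h1, h2, Real.cosh_eq (_ + _), neg_add, Real.exp_add, Real.exp_add, Real.exp_neg (_ / 2), hE]
  have h3 : 4 * (√a * √b) * ((Real.exp (β * (x + h₀)) * (√a / √b) +
      Real.exp (-(β * (x + h₀))) * (√a / √b)⁻¹) / 2) =
      2 * (Real.exp (β * (x + h₀)) * (√a)^2 + Real.exp (-(β * (x + h₀))) * (√b)^2) := by
    field_simp
    ring
  rw [h3, Real.sq_sqrt ha0.le, Real.sq_sqrt hb0.le, ha, hb]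
  simp only [Wt, Real.cosh_eq]
  rw [show β * (x + ε + h₀) = β * (x + h₀) + β * ε by ring,
    show β * (x - ε + h₀) = β * (x + h₀) - β * ε by ring]
  simp only [neg_add, neg_sub, sub_eq_add_neg, Real.exp_add, neg_neg]
  ring

theorem HS (β S : ℝ) (N : ℕ) (hβ : 0 < β) (hN : 0 < N) :
    Integrable (fun x : ℝ => Real.exp (-(β/2) * x^2) ^ N * Real.exp (β * x * S)) ∧
    Real.exp (β / (2 * N) * S^2) = (Real.sqrt (π / (β * N / 2)))⁻¹ *
      ∫ x : ℝ, Real.exp (-(β/2) * x^2) ^ N * Real.exp (β * x * S) := by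
  have hN' : (0:ℝ) < N := by exact_mod_cast hN
  have hb : 0 < β * N / 2 := by positivity
  have e1 : (fun x : ℝ => Real.exp (-(β/2) * x^2) ^ N * Real.exp (β * x * S)) =
      fun x => Real.exp (β / (2 * N) * S^2) * Real.exp (-(β * N / 2) * (x - S / N)^2) := by
    funext x
    rw [← Real.exp_nat_mul, ← Real.exp_add, ← Real.exp_add]
    congr 1
    field_simp
    ring
  rw [e1]
  refine ⟨((integrable_exp_neg_mul_sq hb).comp_sub_right (S / N)).const_mul _, ?_⟩
  rw [integral_const_mul, integral_sub_right_eq_self (fun x => Real.exp (-(β * N / 2) * x^2)) (S/N),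
    integral_gaussian]
  have : 0 < Real.sqrt (π / (β * N / 2)) := Real.sqrt_pos.2 (by positivity)
  field_simp

theorem exp_morH (N : ℕ) (β ε h₀ lam : ℝ) (hβ : 0 < β) (hN : 0 < N) (σ η : Fin N → Bool) :
    Integrable (fun x : ℝ => Real.exp (-(β/2) * x^2) ^ N * ∏ i, wt β ε h₀ lam x (σ i) (η i)) ∧
    Real.exp (morH N β ε h₀ lam σ η) = (Real.sqrt (π / (β * N / 2)))⁻¹ *
      ∫ x : ℝ, Real.exp (-(β/2) * x^2) ^ N * ∏ i, wt β ε h₀ lam x (σ i) (η i) := by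
  obtain ⟨h1, h2⟩ := HS β (∑ i, spin (σ i)) N hβ hN
  set R := Real.exp (β * ∑ i, (ε * spin (η i) + h₀) * spin (σ i) + lam * ∑ i, spin (η i)) with hR
  have e1 : (fun x : ℝ => Real.exp (-(β/2) * x^2) ^ N * ∏ i, wt β ε h₀ lam x (σ i) (η i)) =
      fun x => (Real.exp (-(β/2) * x^2) ^ N * Real.exp (β * x * ∑ i, spin (σ i))) * R := by
    funext x
    rw [mul_assoc, hR, ← Real.exp_add]
    simp only [wt]
    rw [← Real.exp_sum]
    congr 2
    simp only [Finset.mul_sum, ← Finset.sum_add_distrib]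
    exact Finset.sum_congr rfl fun i _ => by ring
  rw [e1]
  refine ⟨h1.mul_const _, ?_⟩
  rw [integral_mul_const, ← mul_assoc, ← h2, hR, ← Real.exp_add, morH, add_assoc]

theorem sum_prod2 (N : ℕ) (f : Fin N → Bool → Bool → ℝ) :
    ∑ σ : Fin N → Bool, ∑ η : Fin N → Bool, ∏ i, f i (σ i) (η i) = ∏ i, ∑ s, ∑ t, f i s t := by
  have h1 : ∀ σ : Fin N → Bool, ∑ η : Fin N → Bool, ∏ i, f i (σ i) (η i) =
      ∏ i, ∑ t, f i (σ i) t := fun σ => by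
    rw [Finset.prod_univ_sum, Fintype.piFinset_univ]
  simp only [h1]
  rw [Finset.prod_univ_sum, Fintype.piFinset_univ]

theorem cyl_sum (N₀ k N : ℕ) (hNk : N = N₀ + k) (β ε h₀ lam x : ℝ) (σbar ηbar : Fin N₀ → Bool) :
    ∑ σ : Fin N → Bool, ∑ η : Fin N → Bool,
    (if ∀ (i : Fin N₀) (h : (i : ℕ) < N), σ ⟨i, h⟩ = σbar i ∧ η ⟨i, h⟩ = ηbar i
    then ∏ i, wt β ε h₀ lam x (σ i) (η i) else 0) =
    (∏ i, wt β ε h₀ lam x (σbar i) (ηbar i)) * Wt β ε h₀ lam x ^ k := by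
  subst hNk
  have h1 : ∀ σ η : Fin (N₀ + k) → Bool,
      (if ∀ (i : Fin N₀) (h : (i : ℕ) < N₀ + k), σ ⟨i, h⟩ = σbar i ∧ η ⟨i, h⟩ = ηbar i
      then ∏ i, wt β ε h₀ lam x (σ i) (η i) else 0) =
      ∏ i : Fin (N₀ + k), (if ∀ h : (i : ℕ) < N₀, σ i = σbar ⟨i, h⟩ ∧ η i = ηbar ⟨i, h⟩ then
        wt β ε h₀ lam x (σ i) (η i) else 0) := fun σ η => by
    rw [Finset.prod_ite_zero]
    have hiff : (∀ (i : Fin N₀) (h : (i : ℕ) < N₀ + k), σ ⟨i, h⟩ = σbar i ∧ η ⟨i, h⟩ = ηbar i) ↔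
        ∀ i ∈ (Finset.univ : Finset (Fin (N₀ + k))), ∀ h : (i : ℕ) < N₀,
          σ i = σbar ⟨i, h⟩ ∧ η i = ηbar ⟨i, h⟩ :=
      ⟨fun h i _ hi => h ⟨i, hi⟩ i.2, fun h i hi => h ⟨i, hi⟩ (Finset.mem_univ _) i.2⟩
    by_cases hc : ∀ (i : Fin N₀) (h : (i : ℕ) < N₀ + k), σ ⟨i, h⟩ = σbar i ∧ η ⟨i, h⟩ = ηbar i
    · rw [if_pos hc, if_pos (hiff.1 hc)]
    · rw [if_neg hc, if_neg (fun h => hc (hiff.2 h))]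
  simp only [h1]
  rw [sum_prod2 (N₀ + k) (fun i s t => if ∀ h : (i : ℕ) < N₀, s = σbar ⟨i, h⟩ ∧ t = ηbar ⟨i, h⟩ then
        wt β ε h₀ lam x s t else 0), Fin.prod_univ_add]
  congr 1
  · refine Finset.prod_congr rfl fun i _ => ?_
    simp only [Fin.val_castAdd, Fin.is_lt, forall_true_left, Fin.eta]
    simp only [ite_and]
    simp
  · rw [← Fin.prod_const]
    refine Finset.prod_congr rfl fun i _ => ?_
    simp [← Wt_sum]

theorem num_eq (N₀ k N : ℕ) (hNk : N = N₀ + k) (hN : 0 < N) (β ε h₀ lam : ℝ) (hβ : 0 < β)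
    (σbar ηbar : Fin N₀ → Bool) :
    ∑ σ : Fin N → Bool, ∑ η : Fin N → Bool,
    (if ∀ (i : Fin N₀) (h : (i : ℕ) < N), σ ⟨i, h⟩ = σbar i ∧ η ⟨i, h⟩ = ηbar i
    then Real.exp (morH N β ε h₀ lam σ η) else 0) =
    (Real.sqrt (π / (β * N / 2)))⁻¹ * ∫ x : ℝ, (Real.exp (-(β/2) * x^2) * Wt β ε h₀ lam x) ^ N *
      ∏ i, piK β ε h₀ lam x (σbar i) (ηbar i) := by
  have e1 : ∀ x, (Real.exp (-(β/2) * x^2) * Wt β ε h₀ lam x) ^ N *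
      ∏ i, piK β ε h₀ lam x (σbar i) (ηbar i) =
      ∑ σ : Fin N → Bool, ∑ η : Fin N → Bool,
      (if ∀ (i : Fin N₀) (h : (i : ℕ) < N), σ ⟨i, h⟩ = σbar i ∧ η ⟨i, h⟩ = ηbar i
      then Real.exp (-(β/2) * x^2) ^ N * ∏ i, wt β ε h₀ lam x (σ i) (η i) else 0) := fun x => by
    have h1 := cyl_sum N₀ k N hNk β ε h₀ lam x σbar ηbar
    simp only [← mul_ite_zero, ← Finset.mul_sum]
    rw [h1, mul_pow, mul_assoc]
    congr 1
    have h2 : ∀ i, piK β ε h₀ lam x (σbar i) (ηbar i) =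
      wt β ε h₀ lam x (σbar i) (ηbar i) / Wt β ε h₀ lam x := fun i => rfl
    simp only [h2, Finset.prod_div_distrib, Fin.prod_const]
    have := (Wt_pos β ε h₀ lam x).ne'
    rw [hNk, pow_add]
    field_simp
  simp only [e1]
  have hi : ∀ σ η : Fin N → Bool, Integrable (fun x : ℝ =>
      (if ∀ (i : Fin N₀) (h : (i : ℕ) < N), σ ⟨i, h⟩ = σbar i ∧ η ⟨i, h⟩ = ηbar i
      then Real.exp (-(β/2) * x^2) ^ N * ∏ i, wt β ε h₀ lam x (σ i) (η i) else 0)) := fun σ η => by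
    split_ifs
    · exact (exp_morH N β ε h₀ lam hβ hN σ η).1
    · simp
  rw [integral_finsetSum _ fun σ _ => integrable_finsetSum _ fun η _ => hi σ η, Finset.mul_sum]
  refine Finset.sum_congr rfl fun σ _ => ?_
  rw [integral_finsetSum _ fun η _ => hi σ η, Finset.mul_sum]
  refine Finset.sum_congr rfl fun η _ => ?_
  split_ifs
  · exact (exp_morH N β ε h₀ lam hβ hN σ η).2
  · simp

theorem morZ_eq (N : ℕ) (hN : 0 < N) (β ε h₀ lam : ℝ) (hβ : 0 < β) :
    morZ N β ε h₀ lam =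
    (Real.sqrt (π / (β * N / 2)))⁻¹ * ∫ x : ℝ, (Real.exp (-(β/2) * x^2) * Wt β ε h₀ lam x) ^ N := by
  have := num_eq 0 N N (by simp) hN β ε h₀ lam hβ (fun _ => true) (fun _ => true)
  simpa [morZ] using this

theorem cyl_eq (N₀ N : ℕ) (hN₀ : N₀ ≤ N) (hN : 0 < N) (β ε h₀ lam : ℝ) (hβ : 0 < β)
    (σbar ηbar : Fin N₀ → Bool) :
    pairCylProb N₀ N β ε h₀ lam σbar ηbar =
    (∫ x : ℝ, (Real.exp (-(β/2) * x^2) * Wt β ε h₀ lam x) ^ N *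
      ∏ i, piK β ε h₀ lam x (σbar i) (ηbar i)) /
    ∫ x : ℝ, (Real.exp (-(β/2) * x^2) * Wt β ε h₀ lam x) ^ N := by
  have h1 : pairCylProb N₀ N β ε h₀ lam σbar ηbar = (∑ σ : Fin N → Bool, ∑ η : Fin N → Bool,
    (if ∀ (i : Fin N₀) (h : (i : ℕ) < N), σ ⟨i, h⟩ = σbar i ∧ η ⟨i, h⟩ = ηbar i
    then Real.exp (morH N β ε h₀ lam σ η) else 0)) / morZ N β ε h₀ lam := by
    simp only [pairCylProb, morK, Finset.sum_div, ite_div, zero_div]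
  have hN' : (0:ℝ) < N := by exact_mod_cast hN
  rw [h1, num_eq N₀ (N - N₀) N (by omega) hN β ε h₀ lam hβ, morZ_eq N hN β ε h₀ lam hβ,
    mul_div_mul_left]
  exact inv_ne_zero (Real.sqrt_pos.2 (by positivity)).ne'

theorem c_tail (β ε h₀ lam : ℝ) (hβ : 0 < β) :
    Integrable (fun x => Real.exp (-(β/2) * x^2) * Wt β ε h₀ lam x) ∧
    Tendsto (fun x => Real.exp (-(β/2) * x^2) * Wt β ε h₀ lam x) (cocompact ℝ) (nhds 0) := by
  set h := h₀ + hbar β ε lam with hh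
  set A := 4 * Real.sqrt (Real.cosh (lam + β * ε) * Real.cosh (lam - β * ε)) with hA
  have e1 : (fun x => Real.exp (-(β/2) * x^2) * Wt β ε h₀ lam x) =
      fun x => A / 2 * Real.exp (β / 2 + β * h) * Real.exp (-(β/2) * (x - 1)^2) +
        A / 2 * Real.exp (β / 2 - β * h) * Real.exp (-(β/2) * (x - (-1))^2) := by
    funext x
    rw [Wt_cosh β ε h₀ lam x hβ, ← hA, ← hh, Real.cosh_eq, mul_assoc (A/2), mul_assoc (A/2), ← Real.exp_add (β/2 + β*h),
      ← Real.exp_add (β/2 - β*h)]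
    rw [show β / 2 + β * h + -(β/2) * (x - 1)^2 = -(β/2) * x^2 + β * (x + h) by ring,
      show β / 2 - β * h + -(β/2) * (x - (-1))^2 = -(β/2) * x^2 + -(β * (x + h)) by ring,
      Real.exp_add, Real.exp_add]
    ring
  have hb : 0 < β / 2 := by positivity
  have ht : Tendsto (fun x : ℝ => Real.exp (-(β/2) * x^2)) (cocompact ℝ) (nhds 0) := by
    refine Real.tendsto_exp_atBot.comp ?_
    have h1 : Tendsto (fun x : ℝ => ‖x‖ ^ 2) (cocompact ℝ) atTop :=
      (tendsto_pow_atTop two_ne_zero).comp tendsto_norm_cocompact_atTop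
    have h2 := h1.const_mul_atTop_of_neg (show -(β/2) < 0 by linarith)
    simpa using h2
  have hs : ∀ a : ℝ, Tendsto (fun x : ℝ => Real.exp (-(β/2) * (x - a)^2)) (cocompact ℝ) (nhds 0) :=
    fun a => ht.comp (Homeomorph.subRight a).isClosedEmbedding.tendsto_cocompact
  rw [e1]
  constructor
  · exact (((integrable_exp_neg_mul_sq hb).comp_sub_right 1).const_mul _).add
      (((integrable_exp_neg_mul_sq hb).comp_sub_right (-1)).const_mul _)
  · simpa using ((hs 1).const_mul (A / 2 * Real.exp (β / 2 + β * h))).add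
      ((hs (-1)).const_mul (A / 2 * Real.exp (β / 2 - β * h)))

theorem piK_bound (β ε h₀ lam x : ℝ) (s t : Bool) : |piK β ε h₀ lam x s t| ≤ 1 := by
  have h1 : piK β ε h₀ lam x s t = wt β ε h₀ lam x s t / Wt β ε h₀ lam x := rfl
  have hp : ∀ s t, 0 < wt β ε h₀ lam x s t := fun s t => Real.exp_pos _
  have hW := Wt_pos β ε h₀ lam x
  rw [h1, abs_of_pos (div_pos (hp s t) hW), div_le_one hW, ← Wt_sum]
  calc wt β ε h₀ lam x s t ≤ ∑ t, wt β ε h₀ lam x s t :=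
        Finset.single_le_sum (f := fun t => wt β ε h₀ lam x s t) (fun t _ => (hp s t).le) (Finset.mem_univ t)
    _ ≤ _ := Finset.single_le_sum (f := fun s => ∑ t, wt β ε h₀ lam x s t)
        (fun s _ => Finset.sum_nonneg fun t _ => (hp s t).le) (Finset.mem_univ s)

theorem Wt_cont (β ε h₀ lam : ℝ) : Continuous (Wt β ε h₀ lam) := by
  unfold Wt; fun_prop

theorem piK_cont (β ε h₀ lam : ℝ) (s t : Bool) : Continuous (fun x => piK β ε h₀ lam x s t) := by
  have h1 : (fun x => piK β ε h₀ lam x s t) = fun x => wt β ε h₀ lam x s t / Wt β ε h₀ lam x := rfl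
  rw [h1]
  refine Continuous.div (by unfold wt; fun_prop) (Wt_cont β ε h₀ lam) fun x => (Wt_pos β ε h₀ lam x).ne'

theorem stmt2 (β ε lam h₀ m : ℝ) (hβ : 0 < β) (hε : 0 < ε)
    (hh : h₀ + hbar β ε lam ≠ 0)
    (hm : m = Real.tanh (β * (m + (h₀ + hbar β ε lam))))
    (hsign : 0 < m * (h₀ + hbar β ε lam)) :
    ∀ (N₀ : ℕ) (σbar ηbar : Fin N₀ → Bool),
      Tendsto (fun N => pairCylProb N₀ N β ε h₀ lam σbar ηbar) atTop
        (nhds (∏ i : Fin N₀, piK β ε h₀ lam m (σbar i) (ηbar i))) := by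
  intro N₀ σbar ηbar
  obtain ⟨ht1, ht2⟩ := c_tail β ε h₀ lam hβ
  have hL := laplace (fun x => Real.exp (-(β/2) * x^2) * Wt β ε h₀ lam x)
    (fun x => ∏ i, piK β ε h₀ lam x (σbar i) (ηbar i)) m
    (by have := Wt_cont β ε h₀ lam; fun_prop)
    (fun x => mul_pos (Real.exp_pos _) (Wt_pos β ε h₀ lam x)) ht1 ht2
    (fun x hx => by
      have h1 := max_all β _ m hβ hm hsign x hx
      have hA : 0 < 4 * Real.sqrt (Real.cosh (lam + β * ε) * Real.cosh (lam - β * ε)) :=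
        mul_pos (by norm_num) (Real.sqrt_pos.2 (mul_pos (Real.cosh_pos _) (Real.cosh_pos _)))
      have h2 := mul_lt_mul_of_pos_left h1 hA
      simp only [Wt_cosh β ε h₀ lam _ hβ]
      linarith)
    (continuous_finsetProd _ fun i _ => piK_cont β ε h₀ lam _ _)
    (fun x => by
      rw [Finset.abs_prod]
      exact Finset.prod_le_one (fun i _ => abs_nonneg _) fun i _ => piK_bound β ε h₀ lam x _ _)
  rw [← tendsto_add_atTop_iff_nat 1]
  refine hL.congr' ?_
  filter_upwards [eventually_ge_atTop N₀] with n hn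
  exact (cyl_eq N₀ (n+1) (by omega) (by omega) β ε h₀ lam hβ σbar ηbar).symm
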